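/- arXiv:0812.4244 — 2 statements merged into one kernel-verified Lean document; each statement's English description precedes it below -/
import Mathlib

section
/- Let Ω ⊂ ℝ² be a bounded open set and ψ : ∂Ω → ℝ continuous. Suppose u solves the variational problem (P), u is continuously differentiable on Ω, and the set {z ∈ Ω : ∇u(z) = 0} has Lebesgue measure zero. Then u is a weak solution of div(f'(‖∇u‖)∇u/‖∇u‖) = 0 in Ω. -/
open Set MeasureTheory Metric Filter
open scoped RealInnerProductSpace Topology Classical

noncomputable section

abbrev E2 := EuclideanSpace ℝ (Fin 2)

/-- A function is Lipschitz on a set (with some constant). -/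
def LipOn (w : E2 → ℝ) (s : Set E2) : Prop := ∃ L : NNReal, LipschitzOnWith L w s

/-- The functional `J(w) = ∫_Ω f(‖∇w‖)`, with `∇w` the a.e.-defined (Rademacher) gradient,
extended by the junk value `0` where `w` is not differentiable. -/
def J (f : ℝ → ℝ) (Ω : Set E2) (w : E2 → ℝ) : ℝ := ∫ x in Ω, f ‖gradient w x‖

/-- The (one-sided at `0`) derivative of `f` on `[0,∞)`. -/
def dtop (f : ℝ → ℝ) : ℝ → ℝ := derivWithin f (Set.Ici 0)

/-- Standing assumptions on the Lagrangian `f` : strictly convex on `[0,∞)`, `C¹` on `[0,∞)`,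
`C²` on `(0,∞)` with `f''` locally Hölder continuous of some exponent `λ ∈ (0,1)`,
and `f'(0) > 0`. -/
def StdF (f : ℝ → ℝ) : Prop :=
  StrictConvexOn ℝ (Set.Ici 0) f ∧ ContDiffOn ℝ 1 f (Set.Ici 0) ∧
  ContDiffOn ℝ 2 f (Set.Ioi 0) ∧
  (∃ lam : NNReal, 0 < lam ∧ lam < 1 ∧ ∀ K : Set ℝ, IsCompact K → K ⊆ Set.Ioi 0 →
    ∃ C : NNReal, HolderOnWith C lam (deriv (dtop f)) K) ∧
  0 < dtop f 0

/-- `u` solves the variational problem (P): `u` is Lipschitz on the closure of `Ω`,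
`u = ψ` on `∂Ω`, and `u` minimizes `J` among such functions. -/
def SolvesP (f : ℝ → ℝ) (Ω : Set E2) (ψ : E2 → ℝ) (u : E2 → ℝ) : Prop :=
  LipOn u (closure Ω) ∧ EqOn u ψ (frontier Ω) ∧
  ∀ w : E2 → ℝ, LipOn w (closure Ω) → EqOn w ψ (frontier Ω) → J f Ω u ≤ J f Ω w

/-- `u` has an isolated critical point in `Ω`. -/
def HasIsolatedCritPt (Ω : Set E2) (u : E2 → ℝ) : Prop :=
  ∃ z₀ ∈ Ω, ∃ r > (0:ℝ), gradient u z₀ = 0 ∧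
    ∀ z ∈ Ω, z ≠ z₀ → dist z z₀ < r → gradient u z ≠ 0

/-- `u` is a weak solution of `div(f'(‖∇u‖)∇u/‖∇u‖) = 0` in `Ω`: the integral identity holds
against every smooth test function compactly supported in `Ω`, the integrand being `0` at
critical points of `u`. -/
def WeakSol (f' : ℝ → ℝ) (Ω : Set E2) (u : E2 → ℝ) : Prop :=
  ∀ φ : E2 → ℝ, ContDiff ℝ (⊤ : ℕ∞) φ → HasCompactSupport φ → tsupport φ ⊆ Ω →
    (∫ z in Ω, (if gradient u z = 0 then 0 else
      f' ‖gradient u z‖ * ⟪(‖gradient u z‖)⁻¹ • gradient u z, gradient φ z⟫)) = 0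

lemma gradient_measurable (w : E2 → ℝ) : Measurable (gradient w) :=
  (InnerProductSpace.toDual ℝ E2).symm.continuous.measurable.comp (measurable_fderiv ℝ w)

lemma gradient_add_const_mul {u φ : E2 → ℝ} {x : E2} (hu : DifferentiableAt ℝ u x)
    (hφ : DifferentiableAt ℝ φ x) (t : ℝ) :
    gradient (fun z => u z + t * φ z) x = gradient u x + t • gradient φ x := by
  refine HasGradientAt.gradient ?_
  rw [hasGradientAt_iff_hasFDerivAt, map_add, map_smul, toDual_gradient, toDual_gradient]
  exact hu.hasFDerivAt.add (hφ.hasFDerivAt.const_mul t)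

lemma norm_gradient_le_of_lipschitzOn {w : E2 → ℝ} {s : Set E2} {x : E2} {L : NNReal}
    (hs : s ∈ 𝓝 x) (hw : LipschitzOnWith L w s) : ‖gradient w x‖ ≤ L := by
  rw [gradient, LinearIsometryEquiv.norm_map]
  exact norm_fderiv_le_of_lipschitzOn ℝ hs hw

lemma hasDerivAt_norm_add_smul {a : E2} (b : E2) (ha : a ≠ 0) :
    HasDerivAt (fun t : ℝ => ‖a + t • b‖) ⟪‖a‖⁻¹ • a, b⟫ 0 := by
  have h1 : HasDerivAt (fun t : ℝ => a + t • b) b 0 := by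
    simpa using ((hasDerivAt_id (0 : ℝ)).smul_const b).const_add a
  have h2 := h1.norm_sq.sqrt (by simpa using ha)
  have ha' : ‖a‖ ≠ 0 := norm_ne_zero_iff.2 ha
  convert h2 using 1
  · funext t
    rw [Real.sqrt_sq (norm_nonneg _)]
  · rw [Real.sqrt_sq (norm_nonneg _), real_inner_smul_left]
    simp only [zero_smul, add_zero]
    field_simp

lemma lipschitzOnWith_comp_norm_add_smul {f : ℝ → ℝ} {K : NNReal} {R : ℝ}
    (hf : LipschitzOnWith K f (Icc 0 R)) {a b : E2} {M : NNReal} (hb : ‖b‖ ≤ M)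
    (hR : ‖a‖ + M ≤ R) :
    LipschitzOnWith (K * M) (fun t : ℝ => f ‖a + t • b‖) (closedBall 0 1) := by
  have hmaps : MapsTo (fun t : ℝ => ‖a + t • b‖) (closedBall 0 1) (Icc 0 R) := by
    intro t ht
    rw [mem_closedBall_zero_iff] at ht
    refine ⟨norm_nonneg _, (norm_add_le _ _).trans ?_⟩
    rw [norm_smul]
    nlinarith [norm_nonneg b, norm_nonneg t]
  refine hf.comp (LipschitzOnWith.of_dist_le_mul fun s _ t _ => ?_) hmaps
  calc dist ‖a + s • b‖ ‖a + t • b‖ ≤ ‖(a + s • b) - (a + t • b)‖ := abs_norm_sub_norm_le _ _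
    _ = ‖b‖ * dist s t := by
        rw [add_sub_add_left_eq_sub, ← sub_smul, norm_smul, dist_eq_norm, mul_comm]
    _ ≤ M * dist s t := by gcongr

lemma continuous_comp_norm {g : ℝ → ℝ} (hg : ContinuousOn g (Ici 0)) :
    Continuous fun v : E2 => g ‖v‖ :=
  hg.comp_continuous continuous_norm fun v => norm_nonneg v

lemma hasDerivAt_dtop {f : ℝ → ℝ} (hf : ContDiffOn ℝ 1 f (Ici 0)) {r : ℝ} (hr : 0 < r) :
    HasDerivAt f (dtop f r) r :=
  ((hf.differentiableOn one_ne_zero) r hr.le).hasDerivWithinAt.hasDerivAt (Ici_mem_nhds hr)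

lemma LipOn.add_const_mul {u φ : E2 → ℝ} {s : Set E2} (hu : LipOn u s) {C : NNReal}
    (hφ : LipschitzWith C φ) (t : ℝ) : LipOn (fun z => u z + t * φ z) s := by
  obtain ⟨L, hL⟩ := hu
  exact ⟨_, hL.add (((lipschitzWith_smul t).comp hφ).lipschitzOnWith)⟩

/-- Differentiation under the integral sign of the energy along `u + t φ`, at `t = 0`. -/
lemma hasDerivAt_J_add_const_mul {f : ℝ → ℝ} (hf : ContDiffOn ℝ 1 f (Ici 0))
    {Ω : Set E2} (hΩo : IsOpen Ω) (hΩb : Bornology.IsBounded Ω) {u φ : E2 → ℝ}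
    (huL : LipOn u Ω) (hud : DifferentiableOn ℝ u Ω)
    (hcrit : volume {z ∈ Ω | gradient u z = 0} = 0)
    {M : NNReal} (hφL : LipschitzWith M φ) (hφd : Differentiable ℝ φ) :
    HasDerivAt (fun t : ℝ => J f Ω fun z => u z + t * φ z)
      (∫ z in Ω, (if gradient u z = 0 then 0 else
        dtop f ‖gradient u z‖ * ⟪(‖gradient u z‖)⁻¹ • gradient u z, gradient φ z⟫)) 0 := by
  obtain ⟨L, hL⟩ := huL
  have : IsFiniteMeasure (volume.restrict Ω) :=
    isFiniteMeasure_restrict.2 hΩb.measure_lt_top.ne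
  have hmem : ∀ᵐ x ∂volume.restrict Ω, x ∈ Ω := ae_restrict_mem hΩo.measurableSet
  have hne : ∀ᵐ x ∂volume.restrict Ω, gradient u x ≠ 0 := by
    rw [ae_restrict_iff' hΩo.measurableSet, ae_iff]
    simpa only [Classical.not_imp, not_not] using hcrit
  have hJ : (fun t : ℝ => J f Ω fun z => u z + t * φ z) =
      fun t => ∫ z in Ω, f ‖gradient u z + t • gradient φ z‖ := by
    funext t
    refine setIntegral_congr_fun hΩo.measurableSet fun z hz => ?_
    simp only [gradient_add_const_mul ((hud z hz).differentiableAt (hΩo.mem_nhds hz)) (hφd z)]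
  have huB : ∀ x ∈ Ω, ‖gradient u x‖ ≤ L := fun x hx =>
    norm_gradient_le_of_lipschitzOn (hΩo.mem_nhds hx) hL
  have hφB : ∀ x, ‖gradient φ x‖ ≤ M := fun x =>
    norm_gradient_le_of_lipschitzOn univ_mem hφL.lipschitzOnWith
  obtain ⟨K, hK⟩ := (hf.mono Icc_subset_Ici_self).exists_lipschitzOnWith one_ne_zero
    (convex_Icc 0 ((L : ℝ) + M)) isCompact_Icc
  have hfc := continuous_comp_norm hf.continuousOn
  have hf'c : Continuous fun v : E2 => dtop f ‖v‖ :=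
    continuous_comp_norm (hf.continuousOn_derivWithin (uniqueDiffOn_Ici 0) le_rfl)
  have hmu := gradient_measurable u
  have hmφ := gradient_measurable φ
  have hFm (t : ℝ) : AEStronglyMeasurable (fun z => f ‖gradient u z + t • gradient φ z‖)
      (volume.restrict Ω) :=
    (hfc.measurable.comp (hmu.add (hmφ.const_smul t))).aestronglyMeasurable
  rw [hJ]
  refine (hasDerivAt_integral_of_dominated_loc_of_lip (bound := fun _ => ((K * M : NNReal) : ℝ))
    (closedBall_mem_nhds 0 one_pos) (.of_forall hFm) ?_ ?_ ?_ (integrable_const _) ?_).2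
  · obtain ⟨C, hC⟩ := (isCompact_Icc (a := (0 : ℝ)) (b := (L : ℝ) + M)).exists_bound_of_continuousOn
      hK.continuousOn
    refine Integrable.of_bound (hFm 0) C ?_
    filter_upwards [hmem] with x hx
    refine hC _ ⟨norm_nonneg _, ?_⟩
    simpa using (huB x hx).trans (le_add_of_nonneg_right M.2)
  · refine Measurable.aestronglyMeasurable (Measurable.ite ?_ measurable_const ?_)
    · exact hmu (measurableSet_singleton 0)
    · exact (hf'c.measurable.comp hmu).mul ((hmu.norm.inv.smul hmu).inner hmφ)
  · filter_upwards [hmem] with x hx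
    rw [Real.nnabs_coe]
    exact lipschitzOnWith_comp_norm_add_smul hK (hφB x) (by gcongr; exact huB x hx)
  · filter_upwards [hne] with x hx
    rw [if_neg hx]
    refine HasDerivAt.comp (h₂ := f) (h := fun t : ℝ => ‖gradient u x + t • gradient φ x‖) 0 ?_
      (hasDerivAt_norm_add_smul _ hx)
    simpa using hasDerivAt_dtop hf (norm_pos_iff.2 hx)

/-- If a `C¹` solution of the variational problem (P) has a critical set of
zero Lebesgue measure, then it is a weak solution of `div(f'(‖∇u‖)∇u/‖∇u‖) = 0` in `Ω`. -/
theorem minimizer_isWeakSolution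
    (f : ℝ → ℝ) (hf : StdF f)
    (Ω : Set E2) (hΩo : IsOpen Ω) (hΩb : Bornology.IsBounded Ω)
    (ψ : E2 → ℝ) (hψ : ContinuousOn ψ (frontier Ω))
    (u : E2 → ℝ) (hu : SolvesP f Ω ψ u) (huC1 : ContDiffOn ℝ 1 u Ω)
    (hcrit : volume {z ∈ Ω | gradient u z = 0} = 0) :
    WeakSol (dtop f) Ω u := by
  intro φ hφ hφc hφs
  obtain ⟨M, hM⟩ := hφ.lipschitzWith_of_hasCompactSupport hφc (by simp)
  obtain ⟨huL, huψ, hmin⟩ := hu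
  have hder := hasDerivAt_J_add_const_mul hf.2.1 hΩo hΩb
    (huL.imp fun _ h => h.mono subset_closure) (huC1.differentiableOn one_ne_zero) hcrit hM
    (hφ.differentiable (by simp))
  refine IsLocalMin.hasDerivAt_eq_zero (.of_forall fun t => ?_) hder
  have hle := hmin (fun z => u z + t * φ z) (huL.add_const_mul hM t) fun z hz => by
    have hzφ : z ∉ tsupport φ := fun h => (hΩo.frontier_eq ▸ hz).2 (hφs h)
    simpa [image_eq_zero_of_notMem_tsupport hzφ] using huψ hz
  simpa using hle
end
end

section
/- Let Ω ⊂ ℝ² be open and let u : Ω → ℝ be continuously differentiable and a weak solution of div(f'(‖∇u‖)∇u/‖∇u‖) = 0 in Ω. Suppose z₀ ∈ Ω and r > 0 are such that the closed ball B̄(z₀,r) ⊂ Ω, ∇u(z₀) = 0, and ∇u(z) ≠ 0 for every z ∈ B̄(z₀,r) \ {z₀}. Then: (i) for every 0 < s ≤ r, ∫₀^{2π} f'(‖∇u(z₀ + s·e(t))‖) ⟨∇u(z₀ + s·e(t))/‖∇u(z₀ + s·e(t))‖, e(t)⟩ s dt = 0, where e(t) = (cos t, sin t) (the period of the 1-form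 f'(‖∇u‖)(−∂ᵧu dx + ∂ₓu dy)/‖∇u‖ around z₀ is null); (ii) there exists a function v, continuous on B̄(z₀,r) and continuously differentiable on B(z₀,r) \ {z₀}, satisfying ∂ₓv = −f'(‖∇u‖)∂ᵧu/‖∇u‖ and ∂ᵧv = f'(‖∇u‖)∂ₓu/‖∇u‖ on B(z₀,r) \ {z₀}; (iii) for such v one has ‖∇v(z)‖ = f'(‖∇u(z)‖) on B(z₀,r) \ {z₀}, so that ‖∇v‖ extends continuously to B(z₀,r). -/
open Set MeasureTheory Metric Filter
open scoped RealInnerProductSpace Topology Classical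

noncomputable section

/-- The unit vector `e(t) = (cos t, sin t)` in the plane. -/
def eVec (t : ℝ) : E2 := (WithLp.equiv 2 (Fin 2 → ℝ)).symm ![Real.cos t, Real.sin t]

section Segment

variable {E : Type*} [NormedAddCommGroup E] [NormedSpace ℝ E] {η : E → E →L[ℝ] ℝ} {z₀ : E}
  {r M : ℝ}

theorem lineMap_mem_closedBall_diff {x : E} (hx : x ∈ closedBall z₀ r) (hne : x ≠ z₀) {t : ℝ}
    (ht : t ∈ Ioc (0 : ℝ) 1) :
    AffineMap.lineMap z₀ x t ∈ closedBall z₀ r \ {z₀} := by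
  refine ⟨?_, ?_⟩
  · rw [mem_closedBall, dist_lineMap_left, Real.norm_of_nonneg ht.1.le, dist_comm]
    exact (mul_le_of_le_one_left dist_nonneg ht.2).trans hx
  · simp [AffineMap.lineMap_eq_left_iff, hne.symm, ht.1.ne']

theorem continuousOn_curveIntegral_segment (hc : ContinuousOn η (closedBall z₀ r \ {z₀}))
    (hM : ∀ x, ‖η x‖ ≤ M) :
    ContinuousOn (fun x ↦ ∫ᶜ y in .segment z₀ x, η y) (closedBall z₀ r) := by
  simp only [curveIntegral_segment]
  intro x hx
  have hbound (y : E) (t : ℝ) : ‖η (AffineMap.lineMap z₀ y t) (y - z₀)‖ ≤ M * ‖y - z₀‖ :=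
    (η _).le_of_opNorm_le (hM _) _
  by_cases hne : x = z₀
  · subst hne
    rw [ContinuousWithinAt]
    simp only [sub_self, map_zero, intervalIntegral.integral_zero]
    refine squeeze_zero_norm (a := fun y ↦ M * ‖y - x‖) (fun y ↦ ?_) ?_
    · simpa using intervalIntegral.norm_integral_le_of_norm_le_const
        (a := 0) (b := 1) fun t _ ↦ hbound y t
    · have : Continuous fun y : E ↦ M * ‖y - x‖ := by fun_prop
      simpa using (this.tendsto x).mono_left nhdsWithin_le_nhds
  have hev : ∀ᶠ y in 𝓝[closedBall z₀ r] x, y ∈ closedBall z₀ r ∧ y ≠ z₀ ∧ ‖y - z₀‖ ≤ r := by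
    filter_upwards [self_mem_nhdsWithin, mem_nhdsWithin_of_mem_nhds (isOpen_ne.mem_nhds hne)]
      with y hy hy'
    exact ⟨hy, hy', by simpa [dist_eq_norm] using hy⟩
  have hM0 : 0 ≤ M := (norm_nonneg _).trans (hM x)
  refine intervalIntegral.continuousWithinAt_of_dominated_interval (bound := fun _ ↦ M * r)
    ?_ ?_ intervalIntegrable_const ?_
  · filter_upwards [hev] with y hy
    rw [uIoc_of_le zero_le_one]
    refine ContinuousOn.aestronglyMeasurable (fun t ht ↦ ?_) measurableSet_Ioc
    have h1 := hc _ (lineMap_mem_closedBall_diff hy.1 hy.2.1 ht)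
    exact (h1.comp AffineMap.lineMap_continuous.continuousWithinAt
      fun s hs ↦ lineMap_mem_closedBall_diff hy.1 hy.2.1 hs).clm_apply continuousWithinAt_const
  · filter_upwards [hev] with y hy
    exact .of_forall fun t _ ↦ (hbound y t).trans (by gcongr; exact hy.2.2)
  · refine .of_forall fun t ht ↦ ?_
    rw [uIoc_of_le zero_le_one] at ht
    have h1 := hc _ (lineMap_mem_closedBall_diff hx hne ht)
    have h2 : ContinuousWithinAt (fun y : E ↦ AffineMap.lineMap z₀ y t)
        (closedBall z₀ r \ {z₀}) x := by
      simp only [AffineMap.lineMap_apply_module]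
      fun_prop
    have h3 : ContinuousWithinAt (fun y : E ↦ η (AffineMap.lineMap z₀ y t))
        (closedBall z₀ r \ {z₀}) x :=
      ContinuousWithinAt.comp (f := fun y : E ↦ AffineMap.lineMap z₀ y t) h1 h2
        fun y hy ↦ lineMap_mem_closedBall_diff hy.1 hy.2 ht
    exact (h3.clm_apply (continuousWithinAt_id.sub continuousWithinAt_const)).mono_of_mem_nhdsWithin
      (inter_mem self_mem_nhdsWithin (mem_nhdsWithin_of_mem_nhds (isOpen_ne.mem_nhds hne)))

end Segment

section WeaklyClosed

open scoped ContDiff Convolution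
open ContinuousLinearMap

variable {E : Type*} [NormedAddCommGroup E] [NormedSpace ℝ E] [FiniteDimensional ℝ E]
  [MeasurableSpace E] [BorelSpace E] {μ : Measure E} [μ.IsAddHaarMeasure]
  {η : E → E →L[ℝ] ℝ} {z₀ : E} {r M : ℝ}

/-- The 1-form `η` is closed on `U` in the sense of distributions. -/
def WeaklyClosedOn (η : E → E →L[ℝ] ℝ) (U : Set E) (μ : Measure E) : Prop :=
  ∀ φ : E → ℝ, ContDiff ℝ ∞ φ → HasCompactSupport φ → tsupport φ ⊆ U →
    ∀ a b : E, ∫ x, (fderiv ℝ φ x a * η x b - fderiv ℝ φ x b * η x a) ∂μ = 0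

/-- The derivative of a mollified 1-form, as an integral. -/
theorem fderiv_convolution_normed_apply (hloc : LocallyIntegrable η μ) (ρ : ContDiffBump (0 : E))
    (x a b : E) :
    Integrable (fun t ↦ fderiv ℝ (ρ.normed μ) t a * η (x - t) b) μ ∧
    fderiv ℝ (ρ.normed μ ⋆[lsmul ℝ ℝ, μ] η) x a b =
      ∫ t, fderiv ℝ (ρ.normed μ) t a * η (x - t) b ∂μ := by
  have hsupp : HasCompactSupport (ρ.normed μ) := ρ.hasCompactSupport_normed
  have hsm : ContDiff ℝ 1 (ρ.normed μ) := ρ.contDiff_normed (n := 1)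
  have hintb : LocallyIntegrable (fun y ↦ η y b) μ := fun y ↦
    let ⟨s, hs, h⟩ := hloc y
    ⟨s, hs, h.apply_continuousLinearMap b⟩
  have hex : Integrable (fun t ↦ (lsmul ℝ ℝ : ℝ →L[ℝ] ℝ →L[ℝ] ℝ).precompL E
      (fderiv ℝ (ρ.normed μ) t) (η (x - t) b)) μ :=
    HasCompactSupport.convolutionExists_left (𝕜 := ℝ) (F := E →L[ℝ] ℝ) ((lsmul ℝ ℝ).precompL E)
      (hsupp.fderiv ℝ) (hsm.continuous_fderiv (by simp)) hintb x
  refine ⟨hex.apply_continuousLinearMap a, ?_⟩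
  have hscalar := hsupp.hasFDerivAt_convolution_left (lsmul ℝ ℝ) hsm hintb x
  have hF : DifferentiableAt ℝ (ρ.normed μ ⋆[lsmul ℝ ℝ, μ] η) x :=
    ((hsupp.contDiff_convolution_left (lsmul ℝ ℝ) hsm hloc).differentiable (by simp)) x
  have heval : (fun y ↦ (ρ.normed μ ⋆[lsmul ℝ ℝ, μ] η) y b) =
      ρ.normed μ ⋆[lsmul ℝ ℝ, μ] fun y ↦ η y b := by
    ext y
    exact ContinuousLinearMap.integral_apply
      (hsupp.convolutionExists_left (lsmul ℝ ℝ) hsm.continuous hloc y) b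
  have h1 : fderiv ℝ (fun y ↦ (ρ.normed μ ⋆[lsmul ℝ ℝ, μ] η) y b) x a =
      fderiv ℝ (ρ.normed μ ⋆[lsmul ℝ ℝ, μ] η) x a b := by
    rw [fderiv_clm_apply hF (differentiableAt_const b)]
    simp
  rw [← h1, heval, hscalar.fderiv]
  exact ContinuousLinearMap.integral_apply hex a

/-- Mollification turns a weakly closed form into a closed one. -/
theorem WeaklyClosedOn.fderiv_convolution_symm {U : Set E} (hη : WeaklyClosedOn η U μ)
    (hloc : LocallyIntegrable η μ) (ρ : ContDiffBump (0 : E)) {x : E}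
    (hx : closedBall x ρ.rOut ⊆ U) (a b : E) :
    fderiv ℝ (ρ.normed μ ⋆[lsmul ℝ ℝ, μ] η) x a b =
      fderiv ℝ (ρ.normed μ ⋆[lsmul ℝ ℝ, μ] η) x b a := by
  have hsupp : HasCompactSupport (ρ.normed μ) := ρ.hasCompactSupport_normed
  have hsm : ContDiff ℝ ∞ (ρ.normed μ) := ρ.contDiff_normed
  have hdiff : Differentiable ℝ (ρ.normed μ) := hsm.differentiable (by simp)
  have hconv := fderiv_convolution_normed_apply hloc ρ x
  rw [(hconv a b).2, (hconv b a).2, ← sub_eq_zero, ← integral_sub (hconv a b).1 (hconv b a).1,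
    ← integral_sub_left_eq_self _ μ x]
  have hfd (y c : E) : fderiv ℝ (ρ.normed μ) (x - y) c
      = - fderiv ℝ (fun y ↦ ρ.normed μ (x - y)) y c := by
    have h : HasFDerivAt (fun y ↦ ρ.normed μ (x - y)) _ y :=
      (hdiff (x - y)).hasFDerivAt.comp y ((hasFDerivAt_id y).const_sub x)
    simp [h.fderiv]
  have htest : tsupport (fun y ↦ ρ.normed μ (x - y)) ⊆ closedBall x ρ.rOut := by
    refine closure_minimal (fun y hy ↦ ?_) isClosed_closedBall
    have : x - y ∈ Function.support (ρ.normed μ) := hy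
    rw [ρ.support_normed_eq, mem_ball_zero_iff, ← dist_eq_norm] at this
    rw [mem_closedBall, dist_comm]
    exact this.le
  have := hη (fun y ↦ ρ.normed μ (x - y)) (hsm.comp (contDiff_const.sub contDiff_id))
    (HasCompactSupport.of_support_subset_isCompact (isCompact_closedBall x ρ.rOut)
      (subset_closure.trans htest)) (htest.trans hx) a b
  rw [← neg_eq_zero, ← integral_neg, ← this]
  refine integral_congr_ae (.of_forall fun y ↦ ?_)
  simp only [hfd, sub_sub_cancel]
  ring

theorem norm_convolution_normed_le (hloc : LocallyIntegrable η μ) (hM : ∀ x, ‖η x‖ ≤ M)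
    (ρ : ContDiffBump (0 : E)) (x : E) :
    ‖(ρ.normed μ ⋆[lsmul ℝ ℝ, μ] η) x‖ ≤ 3 * M := by
  have h := ρ.dist_normed_convolution_le (x₀ := x) (ε := 2 * M) hloc.aestronglyMeasurable
    fun y _ ↦ (dist_le_norm_add_norm _ _).trans (by linarith [hM y, hM x])
  rw [dist_eq_norm] at h
  linarith [norm_le_norm_add_norm_sub' ((ρ.normed μ ⋆[lsmul ℝ ℝ, μ] η) x) (η x), hM x]

/-- The radial primitive of a bounded 1-form that is weakly closed on a ball and continuous off
its center. -/
theorem WeaklyClosedOn.hasFDerivAt_curveIntegral_segment (hη : WeaklyClosedOn η (ball z₀ r) μ)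
    (hloc : LocallyIntegrable η μ) (hc : ContinuousOn η (closedBall z₀ r \ {z₀}))
    (hM : ∀ x, ‖η x‖ ≤ M) {x : E} (hx : x ∈ ball z₀ r \ {z₀}) :
    HasFDerivAt (fun x ↦ ∫ᶜ y in .segment z₀ x, η y) (η x) x := by
  have hopen : IsOpen (ball z₀ r \ {z₀}) := isOpen_ball.sdiff isClosed_singleton
  have hcat {y : E} (hy : y ∈ ball z₀ r \ {z₀}) : ContinuousAt η y :=
    hc.continuousAt (mem_of_superset (hopen.mem_nhds hy)
      (sdiff_subset_sdiff_left ball_subset_closedBall))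
  obtain ⟨R, hxR, hRr⟩ := exists_between (mem_ball.1 hx.1)
  let ρ (n : ℕ) : ContDiffBump (0 : E) :=
    ⟨1 / (n + 1) / 2, 1 / (n + 1), by positivity, half_lt_self (by positivity)⟩
  have hρ : Tendsto (fun n ↦ (ρ n).rOut) atTop (𝓝 0) := tendsto_one_div_add_atTop_nhds_zero_nat
  let η' (n : ℕ) : E → E →L[ℝ] ℝ := (ρ n).normed μ ⋆[lsmul ℝ ℝ, μ] η
  have hη'c (n : ℕ) : ContDiff ℝ 1 (η' n) :=
    (ρ n).hasCompactSupport_normed.contDiff_convolution_left _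
      ((ρ n).contDiff_normed (n := 1)) hloc
  have hlim {y : E} (hy : y ∈ ball z₀ r \ {z₀}) :
      Tendsto (fun q : ℕ × E ↦ η' q.1 q.2) (atTop ×ˢ 𝓝 y) (𝓝 (η y)) :=
    ContDiffBump.convolution_tendsto_right (φ := fun q : ℕ × E ↦ ρ q.1) (g := fun _ ↦ η)
      (hρ.comp tendsto_fst) (.of_forall fun _ ↦ hloc.aestronglyMeasurable)
      ((hcat hy).tendsto.comp tendsto_snd) tendsto_snd
  have hclosed : ∀ᶠ n in atTop, ∀ y ∈ ball z₀ R,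
      HasFDerivAt (fun x ↦ ∫ᶜ y in .segment z₀ x, η' n y) (η' n y) y := by
    filter_upwards [hρ.eventually_lt_const (sub_pos.2 hRr)] with n hn y hy
    have hdiff : Differentiable ℝ (η' n) := (hη'c n).differentiable (by simp)
    refine ((convex_ball
      z₀ R).hasFDerivWithinAt_curveIntegral_segment_of_hasFDerivWithinAt_symmetric
      (fun w _ ↦ (hdiff w).hasFDerivAt.hasFDerivWithinAt)
      (fun w hw a _ b _ ↦ hη.fderiv_convolution_symm hloc (ρ n) ?_ a b)
      (mem_ball_self (dist_nonneg.trans_lt hxR)) hy).hasFDerivAt (isOpen_ball.mem_nhds hy)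
    exact closedBall_subset_ball' (by linarith [mem_ball.1 hw])
  refine hasFDerivAt_of_tendstoUniformlyOnFilter (l := atTop)
    (f := fun n x ↦ ∫ᶜ y in .segment z₀ x, η' n y) (f' := η') ?_ ?_ ?_
  · rw [tendstoUniformlyOnFilter_iff_tendsto]
    exact (((hcat hx).tendsto.comp tendsto_snd).prodMk_nhds
      (hlim hx)).mono_right (nhds_le_uniformity _)
  · filter_upwards [hclosed.prod_mk (isOpen_ball.mem_nhds (mem_ball.2 hxR))] with p hp
    exact hp.1 _ hp.2
  · filter_upwards [hopen.mem_nhds hx] with y hy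
    simp only [curveIntegral_segment]
    refine intervalIntegral.tendsto_integral_filter_of_dominated_convergence
      (fun _ ↦ 3 * M * ‖y - z₀‖) (.of_forall fun n ↦ ?_)
      (.of_forall fun n ↦ .of_forall fun t _ ↦ ?_) intervalIntegrable_const
      (.of_forall fun t ht ↦ ?_)
    · exact (((hη'c n).continuous.comp AffineMap.lineMap_continuous).clm_apply
        continuous_const).aestronglyMeasurable
    · exact (η' n _).le_of_opNorm_le (norm_convolution_normed_le hloc hM (ρ n) _) _
    · rw [uIoc_of_le zero_le_one] at ht
      have hm : AffineMap.lineMap z₀ y t ∈ ball z₀ r \ {z₀} :=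
        have hmem := lineMap_mem_closedBall_diff (mem_closedBall.2 le_rfl) hy.2 ht
        ⟨(mem_closedBall.1 hmem.1).trans_lt hy.1, hmem.2⟩
      have hpt : Tendsto (fun n ↦ η' n (AffineMap.lineMap z₀ y t)) atTop
          (𝓝 (η (AffineMap.lineMap z₀ y t))) :=
        Tendsto.comp (f := fun n ↦ (n, AffineMap.lineMap z₀ y t)) (hlim hm)
          (Tendsto.prodMk tendsto_id tendsto_const_nhds)
      exact ((ContinuousLinearMap.apply ℝ ℝ (y - z₀)).continuous.tendsto _).comp hpt

end WeaklyClosed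

section Planar

open scoped ContDiff

/-- Rotation of the plane by a quarter turn. -/
def quarterTurn (w : E2) : E2 := !₂[-w 1, w 0]

theorem norm_quarterTurn (w : E2) : ‖quarterTurn w‖ = ‖w‖ := by
  simp [EuclideanSpace.norm_eq, quarterTurn, Fin.sum_univ_two, add_comm]

theorem inner_quarterTurn_left (w a : E2) : ⟪quarterTurn w, a⟫ = w 0 * a 1 - w 1 * a 0 := by
  simp [quarterTurn, PiLp.inner_apply, Fin.sum_univ_two]
  ring

theorem continuous_quarterTurn : Continuous quarterTurn := by
  unfold quarterTurn
  fun_prop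

theorem inner_gradient_mul_quarterTurn_sub (w g a b : E2) :
    ⟪g, a⟫ * ⟪quarterTurn w, b⟫ - ⟪g, b⟫ * ⟪quarterTurn w, a⟫ =
      (a 0 * b 1 - a 1 * b 0) * ⟪w, g⟫ := by
  simp only [inner_quarterTurn_left]
  simp [PiLp.inner_apply, Fin.sum_univ_two]
  ring

variable {V : E2 → E2} {v : E2 → ℝ} {z₀ : E2} {r M : ℝ}

/-- A bounded weakly divergence-free planar field, continuous off the center of a ball, has a
stream function there. -/
theorem exists_streamFunction (hc : ContinuousOn V (closedBall z₀ r \ {z₀}))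
    (hM : ∀ z ∈ closedBall z₀ r \ {z₀}, ‖V z‖ ≤ M)
    (hdiv : ∀ φ : E2 → ℝ, ContDiff ℝ ∞ φ → HasCompactSupport φ → tsupport φ ⊆ ball z₀ r →
      ∫ z in closedBall z₀ r \ {z₀}, ⟪V z, gradient φ z⟫ = 0) :
    ∃ v : E2 → ℝ, ContinuousOn v (closedBall z₀ r) ∧
      ∀ z ∈ ball z₀ r \ {z₀}, HasGradientAt v (quarterTurn (V z)) z := by
  set K := closedBall z₀ r \ {z₀}
  have hKm : MeasurableSet K := measurableSet_closedBall.diff (measurableSet_singleton z₀)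
  let form : E2 → E2 →L[ℝ] ℝ := fun z ↦ InnerProductSpace.toDual ℝ E2 (quarterTurn (V z))
  have hform : ContinuousOn form K :=
    (InnerProductSpace.toDual ℝ E2).continuous.comp_continuousOn
      (continuous_quarterTurn.comp_continuousOn hc)
  let η : E2 → E2 →L[ℝ] ℝ := K.indicator form
  have hηK : EqOn η form K := fun z hz ↦ indicator_of_mem hz form
  have hηc : ContinuousOn η K := hform.congr hηK
  have hηM (z : E2) : ‖η z‖ ≤ max M 0 := by
    by_cases hz : z ∈ K
    · rw [hηK hz]
      simpa [form, norm_quarterTurn] using Or.inl (hM z hz)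
    · simp [η, hz]
  have hloc : LocallyIntegrable η volume := by
    suffices h : IntegrableOn form K volume from
      (IntegrableOn.integrable_indicator (ε' := E2 →L[ℝ] ℝ) h hKm).locallyIntegrable
    refine IntegrableOn.of_bound
      ((measure_mono sdiff_subset).trans_lt measure_closedBall_lt_top)
      (hform.aestronglyMeasurable hKm) M ?_
    filter_upwards [ae_restrict_mem hKm] with z hz
    simpa [form, norm_quarterTurn] using hM z hz
  have hclosed : WeaklyClosedOn η (ball z₀ r) volume := by
    intro φ hφ hφc hφs a b
    have hpt : (fun z ↦ fderiv ℝ φ z a * η z b - fderiv ℝ φ z b * η z a) =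
        K.indicator fun z ↦ (a 0 * b 1 - a 1 * b 0) * ⟪V z, gradient φ z⟫ := by
      ext z
      by_cases hz : z ∈ K
      · rw [hηK hz, indicator_of_mem hz, ← inner_gradient_mul_quarterTurn_sub]
        simp [form]
      · simp [η, hz]
    rw [hpt, integral_indicator hKm, integral_const_mul, hdiv φ hφ hφc hφs, mul_zero]
  refine ⟨fun x ↦ ∫ᶜ y in .segment z₀ x, η y, continuousOn_curveIntegral_segment hηc hηM,
    fun z hz ↦ ?_⟩
  have h := hclosed.hasFDerivAt_curveIntegral_segment hloc hηc hηM hz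
  rwa [hηK ⟨ball_subset_closedBall hz.1, hz.2⟩] at h

theorem norm_eVec (t : ℝ) : ‖eVec t‖ = 1 := by
  simp [EuclideanSpace.norm_eq, eVec, Fin.sum_univ_two]

theorem hasDerivAt_eVec (t : ℝ) : HasDerivAt eVec (quarterTurn (eVec t)) t := by
  have h : HasDerivAt (fun s ↦ ![Real.cos s, Real.sin s]) ![-Real.sin t, Real.cos t] t := by
    refine hasDerivAt_pi.2 fun i ↦ ?_
    fin_cases i
    · exact Real.hasDerivAt_cos t
    · exact Real.hasDerivAt_sin t
  exact (PiLp.continuousLinearEquiv 2 ℝ fun _ : Fin 2 ↦ ℝ).symm.hasFDerivAt.comp_hasDerivAt t h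

theorem inner_quarterTurn_quarterTurn (w a : E2) : ⟪quarterTurn w, quarterTurn a⟫ = ⟪w, a⟫ := by
  rw [inner_quarterTurn_left]
  simp [quarterTurn, PiLp.inner_apply, Fin.sum_univ_two]
  ring

theorem add_smul_eVec_mem {s : ℝ} (hs : s ∈ Ioc 0 r) (t : ℝ) :
    z₀ + s • eVec t ∈ closedBall z₀ r \ {z₀} := by
  have hnorm : ‖s • eVec t‖ = s := by
    rw [norm_smul, norm_eVec, mul_one, Real.norm_of_nonneg hs.1.le]
  refine ⟨by simpa [hnorm] using hs.2, fun h ↦ hs.1.ne' ?_⟩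
  rw [← hnorm, add_eq_left.1 h, norm_zero]

/-- A bounded field with a stream function has no flux through the circles around the center. -/
theorem flux_eq_zero (hc : ContinuousOn V (closedBall z₀ r \ {z₀}))
    (hM : ∀ z ∈ closedBall z₀ r \ {z₀}, ‖V z‖ ≤ M)
    (hv : ∀ z ∈ ball z₀ r \ {z₀}, HasGradientAt v (quarterTurn (V z)) z) {s : ℝ}
    (hs : s ∈ Ioc 0 r) :
    ∫ t in (0 : ℝ)..(2 * Real.pi), ⟪V (z₀ + s • eVec t), eVec t⟫ * s = 0 := by
  have he : Continuous eVec :=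
    continuous_iff_continuousAt.2 fun t ↦ (hasDerivAt_eVec t).continuousAt
  have hcont {σ : ℝ} (hσ : σ ∈ Ioc 0 r) :
      Continuous fun t ↦ ⟪V (z₀ + σ • eVec t), eVec t⟫ * σ :=
    ((hc.comp_continuous (by fun_prop) (add_smul_eVec_mem hσ)).inner he).mul continuous_const
  have hsmall {σ : ℝ} (hσ : σ ∈ Ioo 0 r) :
      ∫ t in (0 : ℝ)..(2 * Real.pi), ⟪V (z₀ + σ • eVec t), eVec t⟫ * σ = 0 := by
    have hσ' : σ ∈ Ioc 0 r := ⟨hσ.1, hσ.2.le⟩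
    have hderiv (t : ℝ) : HasDerivAt (fun t ↦ v (z₀ + σ • eVec t))
        (⟪V (z₀ + σ • eVec t), eVec t⟫ * σ) t := by
      have hmem : z₀ + σ • eVec t ∈ ball z₀ r \ {z₀} := by
        refine ⟨?_, (add_smul_eVec_mem hσ' t).2⟩
        simpa [norm_smul, norm_eVec, abs_of_pos hσ.1] using hσ.2
      have h := (hv _ hmem).hasFDerivAt.comp_hasDerivAt t
        (((hasDerivAt_eVec t).const_smul σ).const_add z₀)
      rwa [InnerProductSpace.toDual_apply_apply, inner_smul_right, inner_quarterTurn_quarterTurn,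
        mul_comm] at h
    rw [intervalIntegral.integral_eq_sub_of_hasDerivAt (fun t _ ↦ hderiv t)
      ((hcont hσ').intervalIntegrable _ _)]
    simp [eVec]
  rcases hs.2.lt_or_eq with hlt | rfl
  · exact hsmall ⟨hs.1, hlt⟩
  have hmem : Ioo 0 s ∈ 𝓝[<] s := Ioo_mem_nhdsLT hs.1
  have hlim : ContinuousWithinAt
      (fun σ ↦ ∫ t in (0 : ℝ)..(2 * Real.pi), ⟪V (z₀ + σ • eVec t), eVec t⟫ * σ) (Iio s) s := by
    refine intervalIntegral.continuousWithinAt_of_dominated_interval (bound := fun _ ↦ M * s)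
      ?_ ?_ intervalIntegrable_const ?_
    · filter_upwards [hmem] with σ hσ
      exact (hcont ⟨hσ.1, hσ.2.le⟩).aestronglyMeasurable
    · filter_upwards [hmem] with σ hσ
      refine .of_forall fun t _ ↦ ?_
      have hVM := hM _ (add_smul_eVec_mem ⟨hσ.1, hσ.2.le⟩ t)
      rw [norm_mul, Real.norm_of_nonneg hσ.1.le]
      refine mul_le_mul ((norm_inner_le_norm _ _).trans ?_) hσ.2.le hσ.1.le
        ((norm_nonneg _).trans hVM)
      rwa [norm_eVec, mul_one]
    · refine .of_forall fun t _ ↦ ContinuousWithinAt.mono_of_mem_nhdsWithin (t := Ioc 0 s) ?_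
        (mem_of_superset hmem Ioo_subset_Ioc_self)
      have hline : ContinuousWithinAt (fun σ : ℝ ↦ z₀ + σ • eVec t) (Ioc 0 s) s := by fun_prop
      exact ((ContinuousWithinAt.comp (f := fun σ : ℝ ↦ z₀ + σ • eVec t)
        (hc _ (add_smul_eVec_mem hs t)) hline fun σ hσ ↦ add_smul_eVec_mem hσ t).inner
          continuousWithinAt_const).mul continuousWithinAt_id
  refine tendsto_nhds_unique hlim (tendsto_const_nhds.congr' ?_)
  filter_upwards [hmem] with σ hσ
  exact (hsmall hσ).symm

end Planar

section Lagrangian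

variable {f : ℝ → ℝ}

theorem StdF.continuousOn_dtop (hf : StdF f) : ContinuousOn (dtop f) (Ici 0) :=
  hf.2.1.continuousOn_derivWithin (uniqueDiffOn_Ici 0) le_rfl

theorem StdF.dtop_pos (hf : StdF f) {x : ℝ} (hx : 0 ≤ x) : 0 < dtop f x :=
  hf.2.2.2.2.trans_le <| hf.1.convexOn.monotoneOn_derivWithin
    (hf.2.1.differentiableOn one_ne_zero) self_mem_Ici hx hx

theorem continuousOn_gradient {u : E2 → ℝ} {Ω : Set E2} (hΩ : IsOpen Ω)
    (hu : ContDiffOn ℝ 1 u Ω) : ContinuousOn (gradient u) Ω :=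
  (InnerProductSpace.toDual ℝ E2).symm.continuous.comp_continuousOn
    (hu.continuousOn_fderiv_of_isOpen hΩ le_rfl)

end Lagrangian

/-- Existence of a stream function around an isolated critical point of a `C¹`
weak solution of `div(f'(‖∇u‖)∇u/‖∇u‖) = 0`: (i) the period of the associated 1-form around
`z₀` vanishes; (ii) a stream function `v` exists, continuous on the closed ball and `C¹` off
the center; (iii) `‖∇v‖ = f'(‖∇u‖)` off the center, so `‖∇v‖` extends continuously. -/
theorem stream_function_existence
    (f : ℝ → ℝ) (hf : StdF f)
    (Ω : Set E2) (hΩo : IsOpen Ω)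
    (u : E2 → ℝ) (huC1 : ContDiffOn ℝ 1 u Ω) (hu : WeakSol (dtop f) Ω u)
    (z₀ : E2) (r : ℝ) (hr : 0 < r) (hball : closedBall z₀ r ⊆ Ω)
    (hz₀ : gradient u z₀ = 0)
    (hiso : ∀ z ∈ closedBall z₀ r, z ≠ z₀ → gradient u z ≠ 0) :
    -- (i) the period of the 1-form around `z₀` is null
    (∀ s : ℝ, 0 < s → s ≤ r →
      (∫ t in (0:ℝ)..(2 * Real.pi),
        dtop f ‖gradient u (z₀ + s • eVec t)‖ *
          ⟪(‖gradient u (z₀ + s • eVec t)‖)⁻¹ • gradient u (z₀ + s • eVec t), eVec t⟫ * s) = 0) ∧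
    -- (ii) existence of the stream function, with (iii)
    ∃ v : E2 → ℝ, ContinuousOn v (closedBall z₀ r) ∧
      ContDiffOn ℝ 1 v (ball z₀ r \ {z₀}) ∧
      (∀ z ∈ ball z₀ r \ {z₀},
        gradient v z 0 = -(dtop f ‖gradient u z‖ * (gradient u z 1) / ‖gradient u z‖) ∧
        gradient v z 1 = dtop f ‖gradient u z‖ * (gradient u z 0) / ‖gradient u z‖) ∧
      (∀ z ∈ ball z₀ r \ {z₀}, ‖gradient v z‖ = dtop f ‖gradient u z‖) ∧
      ∃ m : E2 → ℝ, ContinuousOn m (ball z₀ r) ∧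
        ∀ z ∈ ball z₀ r \ {z₀}, m z = ‖gradient v z‖ := by
  set K := closedBall z₀ r \ {z₀} with hK
  let V : E2 → E2 := fun z ↦ dtop f ‖gradient u z‖ • ((‖gradient u z‖)⁻¹ • gradient u z)
  have hg : ContinuousOn (gradient u) (closedBall z₀ r) :=
    (continuousOn_gradient hΩo huC1).mono hball
  have hm : ContinuousOn (fun z ↦ dtop f ‖gradient u z‖) (closedBall z₀ r) :=
    hf.continuousOn_dtop.comp hg.norm fun z _ ↦ norm_nonneg _
  have hKball : K ⊆ closedBall z₀ r := sdiff_subset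
  have hne {z : E2} (hz : z ∈ K) : gradient u z ≠ 0 := hiso z hz.1 hz.2
  have hVc : ContinuousOn V K :=
    (hm.mono hKball).smul (((hg.mono hKball).norm.inv₀ fun z hz ↦ norm_ne_zero_iff.2 (hne hz)).smul
      (hg.mono hKball))
  have hVnorm {z : E2} (hz : z ∈ K) : ‖V z‖ = dtop f ‖gradient u z‖ := by
    rw [norm_smul, norm_smul, norm_inv, norm_norm,
      inv_mul_cancel₀ (norm_ne_zero_iff.2 (hne hz)), mul_one,
      Real.norm_of_nonneg (hf.dtop_pos (norm_nonneg _)).le]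
  obtain ⟨M, hM⟩ := (isCompact_closedBall z₀ r).exists_bound_of_continuousOn hm
  have hVM : ∀ z ∈ K, ‖V z‖ ≤ M := fun z hz ↦
    (hVnorm hz).trans_le ((Real.le_norm_self _).trans (hM z hz.1))
  obtain ⟨v, hvc, hv⟩ := exists_streamFunction hVc hVM fun φ hφ hφc hφs ↦ by
    have hweak := hu φ hφ hφc (hφs.trans (ball_subset_closedBall.trans hball))
    rw [← hweak, ← integral_indicator
      (measurableSet_closedBall.diff (measurableSet_singleton z₀)),
      ← integral_indicator hΩo.measurableSet]
    refine integral_congr_ae (.of_forall fun z ↦ ?_)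
    rw [← hK]
    by_cases hz : z ∈ K
    · simp only [indicator_of_mem hz, indicator_of_mem (hball hz.1), if_neg (hne hz), V]
      rw [real_inner_smul_left]
    rw [indicator_of_notMem hz]
    by_cases hz₁ : z = z₀
    · simp [hz₁, hz₀, indicator]
    have hφz : gradient φ z = 0 := by
      have hnot : z ∉ tsupport φ := fun h ↦ hz ⟨ball_subset_closedBall (hφs h), hz₁⟩
      rw [gradient, image_eq_zero_of_notMem_tsupport fun h ↦ hnot (tsupport_fderiv_subset ℝ h),
        map_zero]
    simp [hφz, indicator]
  have hsub : ball z₀ r \ {z₀} ⊆ K := sdiff_subset_sdiff_left ball_subset_closedBall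
  have hopen : IsOpen (ball z₀ r \ {z₀}) := isOpen_ball.sdiff isClosed_singleton
  have hnorm {z : E2} (hz : z ∈ ball z₀ r \ {z₀}) : ‖gradient v z‖ = dtop f ‖gradient u z‖ := by
    rw [(hv z hz).gradient, norm_quarterTurn, hVnorm (hsub hz)]
  refine ⟨fun s hs hsr ↦ ?_, v, hvc, ?_, fun z hz ↦ ?_, fun z hz ↦ hnorm hz,
    fun z ↦ dtop f ‖gradient u z‖, hm.mono ball_subset_closedBall, fun z hz ↦ (hnorm hz).symm⟩
  · simpa only [V, real_inner_smul_left] using flux_eq_zero hVc hVM hv ⟨hs, hsr⟩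
  · rw [show (1 : WithTop ℕ∞) = 0 + 1 from rfl, contDiffOn_succ_iff_fderiv_of_isOpen hopen]
    refine ⟨fun z hz ↦ (hv z hz).differentiableAt.differentiableWithinAt, by simp, ?_⟩
    rw [contDiffOn_zero]
    exact ((InnerProductSpace.toDual ℝ E2).continuous.comp_continuousOn
      (continuous_quarterTurn.comp_continuousOn (hVc.mono hsub))).congr
        fun z hz ↦ (hv z hz).hasFDerivAt.fderiv
  · rw [(hv z hz).gradient]
    simp only [quarterTurn, V, PiLp.smul_apply, smul_eq_mul, div_eq_mul_inv]
    constructor <;> simp <;> ring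
end
end
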